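/- The Herglotz function F is differentiable on (0,∞) with F′(1) = 1, and for all coprime positive integers p and q: (p/q)·F′(p/q) − 1 = ∑_{α: α^p = 1} ( ∑_{β: β^q = 1, β ≠ 1} g(α,β) − ∑_{β: β^p = 1, β ≠ 1} g(α,β) ), where for roots of unity α, β, g(α,β) = −∫₀¹ α·log(y)/((1 − αy)·(1 − βy)) dy. -/

import Mathlib

open Real

/-- The digamma function ψ = Γ′/Γ. -/
noncomputable def digamma (x : ℝ) : ℝ := deriv Real.Gamma x / Real.Gamma x

/-- The Herglotz function F(x) = ∑_{n≥1} (ψ(nx) − log(nx))/n. -/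
noncomputable def herglotzF (x : ℝ) : ℝ :=
  ∑' n : ℕ, (digamma (((n : ℝ) + 1) * x) - Real.log (((n : ℝ) + 1) * x)) / ((n : ℝ) + 1)

/-- The root of unity e^{2πik/m}. -/
noncomputable def rootOfUnity (k m : ℕ) : ℂ :=
  Complex.exp (2 * (Real.pi : ℂ) * Complex.I * k / m)

/-- g(α,β) = −∫₀¹ α·log(y)/((1−αy)(1−βy)) dy. -/
noncomputable def gInt (α β : ℂ) : ℂ :=
  -∫ y in (0:ℝ)..1, α * Complex.log (y : ℂ) / ((1 - α * (y : ℂ)) * (1 - β * (y : ℂ)))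

/-- The forward difference `1/v - log(v+1) + log v` of `ψ - log` at `v`. -/
noncomputable def digammaStep (v : ℝ) : ℝ := 1 / v - Real.log (v + 1) + Real.log v

/-- The negative of the derivative of `digammaStep`. -/
noncomputable def herglotzKernel (v : ℝ) : ℝ := 1 / (v ^ 2 * (v + 1))

theorem hasDerivAt_log_Gamma {x : ℝ} (hx : 0 < x) :
    HasDerivAt (Real.log ∘ Real.Gamma) (digamma x) x := by
  have hd : DifferentiableAt ℝ Real.Gamma x := Real.differentiableAt_Gamma fun m h => by
    have : (0 : ℝ) ≤ m := m.cast_nonneg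
    linarith
  exact hd.hasDerivAt.log (Real.Gamma_pos_of_pos hx).ne'

theorem log_Gamma_add_one {x : ℝ} (hx : 0 < x) :
    Real.log (Real.Gamma (x + 1)) = Real.log x + Real.log (Real.Gamma x) := by
  rw [Real.Gamma_add_one hx.ne', Real.log_mul hx.ne' (Real.Gamma_pos_of_pos hx).ne']

theorem digamma_add_one {x : ℝ} (hx : 0 < x) : digamma (x + 1) = digamma x + 1 / x := by
  have h1 : HasDerivAt (fun y => (Real.log ∘ Real.Gamma) (y + 1)) (digamma (x + 1)) x :=
    (hasDerivAt_log_Gamma (by linarith : 0 < x + 1)).comp_add_const x 1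
  have h2 := (Real.hasDerivAt_log hx.ne').add (hasDerivAt_log_Gamma hx)
  have h3 : (fun y => (Real.log ∘ Real.Gamma) (y + 1)) =ᶠ[nhds x]
      (Real.log + Real.log ∘ Real.Gamma) := by
    filter_upwards [lt_mem_nhds hx] with y hy
    simpa using log_Gamma_add_one hy
  rw [h1.unique (h2.congr_of_eventuallyEq h3), one_div, add_comm]

theorem slope_log_Gamma {x : ℝ} (hx : 0 < x) :
    slope (Real.log ∘ Real.Gamma) x (x + 1) = Real.log x := by
  simp [slope_def_field, log_Gamma_add_one hx]

theorem digamma_le_log {x : ℝ} (hx : 0 < x) : digamma x ≤ Real.log x := by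
  rw [← slope_log_Gamma hx]
  exact Real.convexOn_log_Gamma.le_slope_of_hasDerivAt hx (by simp; linarith) (by linarith)
    (hasDerivAt_log_Gamma hx)

theorem log_le_digamma_add {x : ℝ} (hx : 0 < x) : Real.log x ≤ digamma x + 1 / x := by
  rw [← slope_log_Gamma hx, ← digamma_add_one hx]
  exact Real.convexOn_log_Gamma.slope_le_of_hasDerivAt hx (by simp; linarith) (by linarith)
    (hasDerivAt_log_Gamma (by linarith))

theorem log_add_one_sub_log {v : ℝ} (hv : 0 < v) :
    Real.log (v + 1) - Real.log v = Real.log (1 + 1 / v) := by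
  rw [← Real.log_div (by linarith) hv.ne']
  congr 1
  field_simp

theorem digammaStep_nonneg {v : ℝ} (hv : 0 < v) : 0 ≤ digammaStep v := by
  have h := Real.log_le_sub_one_of_pos (by positivity : 0 < 1 + 1 / v)
  rw [← log_add_one_sub_log hv] at h
  unfold digammaStep
  linarith

theorem digammaStep_le {v : ℝ} (hv : 0 < v) : digammaStep v ≤ 1 / v ^ 2 := by
  have h := Real.one_sub_inv_le_log_of_pos (by positivity : 0 < 1 + 1 / v)
  rw [← log_add_one_sub_log hv] at h
  have h1 : 1 / v - (1 - (1 + 1 / v)⁻¹) ≤ 1 / v ^ 2 := by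
    have : 1 / v - (1 - (1 + 1 / v)⁻¹) = 1 / (v * (v + 1)) := by
      field_simp
      ring
    rw [this]
    gcongr
    nlinarith
  unfold digammaStep
  linarith

theorem hasSum_digammaStep {x : ℝ} (hx : 0 < x) :
    HasSum (fun m : ℕ => digammaStep (x + m)) (Real.log x - digamma x) := by
  have hpos (m : ℕ) : 0 < x + m := by positivity
  rw [hasSum_iff_tendsto_nat_of_nonneg fun m => digammaStep_nonneg (hpos m)]
  have hsum (N : ℕ) : ∑ m ∈ Finset.range N, digammaStep (x + m) =
      (digamma (x + N) - Real.log (x + N)) + (Real.log x - digamma x) := by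
    induction N with
    | zero => simp
    | succ N ih =>
      rw [Finset.sum_range_succ, ih, digammaStep]
      push_cast
      rw [← add_assoc x, digamma_add_one (hpos N)]
      ring
  simp_rw [hsum]
  have hlim : Filter.Tendsto (fun N : ℕ => -(1 / (x + N))) Filter.atTop (nhds 0) := by
    rw [← neg_zero]
    simp_rw [one_div]
    exact (tendsto_inv_atTop_zero.comp
      (Filter.tendsto_atTop_add_const_left _ x tendsto_natCast_atTop_atTop)).neg
  have h0 : Filter.Tendsto (fun N : ℕ => digamma (x + N) - Real.log (x + N))
      Filter.atTop (nhds 0) :=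
    tendsto_of_tendsto_of_tendsto_of_le_of_le hlim tendsto_const_nhds
      (fun N => by have := log_le_digamma_add (hpos N); simp only; linarith)
      (fun N => by have := digamma_le_log (hpos N); simp only; linarith)
  simpa using h0.add_const (Real.log x - digamma x)

theorem hasDerivAt_digammaStep {v : ℝ} (hv : 0 < v) :
    HasDerivAt digammaStep (-herglotzKernel v) v := by
  have h1 : HasDerivAt (fun v : ℝ => 1 / v) (-(v ^ 2)⁻¹) v := by
    simpa using hasDerivAt_inv hv.ne'
  have h2 : HasDerivAt (fun v : ℝ => Real.log (v + 1)) (v + 1)⁻¹ v :=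
    (Real.hasDerivAt_log (by linarith : v + 1 ≠ 0)).comp_add_const v 1
  refine ((h1.sub h2).add (Real.hasDerivAt_log hv.ne')).congr_deriv ?_
  unfold herglotzKernel
  field_simp
  ring

theorem summable_prod_majorant :
    Summable fun p : ℕ × ℕ => 1 / (((p.1 : ℝ) + 1) * (p.1 + 1 + p.2) ^ 2) := by
  have hs : Summable fun n : ℕ => 1 / ((n : ℝ) + 1) ^ (3 / 2 : ℝ) := by
    have := (Real.summable_one_div_nat_add_rpow 1 (3 / 2)).2 (by norm_num)
    refine this.congr fun n => ?_
    rw [abs_of_pos (by positivity)]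
  refine (hs.mul_of_nonneg hs (fun n => by positivity) fun n => by positivity).of_nonneg_of_le
    (fun p => by positivity) fun p => ?_
  rw [div_mul_div_comm, one_mul]
  have hp1 : (0 : ℝ) ≤ p.1 := p.1.cast_nonneg
  have hp2 : (0 : ℝ) ≤ p.2 := p.2.cast_nonneg
  set s : ℝ := p.1 + 1 + p.2 with hs
  have hs0 : 0 < s := by positivity
  have h1 : ((p.1 : ℝ) + 1) ^ (3 / 2 : ℝ) = (p.1 + 1) * (p.1 + 1 : ℝ) ^ (1 / 2 : ℝ) := by
    rw [← Real.rpow_one_add' (by positivity) (by norm_num)]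
    norm_num
  have h2 : s ^ 2 = s ^ (1 / 2 : ℝ) * s ^ (3 / 2 : ℝ) := by
    rw [← Real.rpow_add hs0, ← Real.rpow_natCast]
    norm_num
  rw [h1, h2, mul_assoc]
  gcongr <;> linarith

theorem affine_lower_bound {a x : ℝ} (ha1 : a ≤ 1) (hx : a ≤ x) (p : ℕ × ℕ) :
    a * (p.1 + 1 + p.2) ≤ ((p.1 : ℝ) + 1) * x + p.2 := by
  have hp1 : (0 : ℝ) ≤ p.1 := p.1.cast_nonneg
  have hp2 : (0 : ℝ) ≤ p.2 := p.2.cast_nonneg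
  nlinarith [mul_nonneg hp1 (sub_nonneg.2 hx), mul_nonneg hp2 (sub_nonneg.2 ha1)]

theorem summable_digammaStep_prod {x : ℝ} (hx : 0 < x) :
    Summable fun p : ℕ × ℕ => -digammaStep (((p.1 : ℝ) + 1) * x + p.2) / (p.1 + 1) := by
  have ha : 0 < min x 1 := lt_min hx one_pos
  refine Summable.of_norm_bounded (summable_prod_majorant.mul_left (1 / (min x 1) ^ 2)) fun p => ?_
  have hlow := affine_lower_bound (min_le_right _ _) (min_le_left x 1) p
  have hv : 0 < ((p.1 : ℝ) + 1) * x + p.2 := by positivity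
  rw [neg_div, norm_neg, Real.norm_of_nonneg
    (div_nonneg (digammaStep_nonneg hv) (by positivity))]
  calc digammaStep (((p.1 : ℝ) + 1) * x + p.2) / (p.1 + 1)
      ≤ 1 / (((p.1 : ℝ) + 1) * x + p.2) ^ 2 / (p.1 + 1) := by
        gcongr
        exact digammaStep_le hv
    _ ≤ 1 / (min x 1 * (p.1 + 1 + p.2)) ^ 2 / (p.1 + 1) := by gcongr
    _ = 1 / (min x 1) ^ 2 * (1 / (((p.1 : ℝ) + 1) * (p.1 + 1 + p.2) ^ 2)) := by
        field_simp

theorem herglotzF_eq_tsum_prod {x : ℝ} (hx : 0 < x) :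
    herglotzF x =
      ∑' p : ℕ × ℕ, -digammaStep (((p.1 : ℝ) + 1) * x + p.2) / (p.1 + 1) := by
  refine HasSum.tsum_eq ((summable_digammaStep_prod hx).hasSum.prod_fiberwise fun n => ?_)
  have h := ((hasSum_digammaStep (by positivity : 0 < ((n : ℝ) + 1) * x)).neg).div_const
    ((n : ℝ) + 1)
  rwa [neg_sub] at h

theorem herglotzKernel_nonneg {v : ℝ} (hv : 0 < v) : 0 ≤ herglotzKernel v := by
  unfold herglotzKernel
  positivity

theorem herglotzKernel_le {a x : ℝ} (ha : 0 < a) (ha1 : a ≤ 1) (hx : a ≤ x) (p : ℕ × ℕ) :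
    herglotzKernel (((p.1 : ℝ) + 1) * x + p.2) ≤
      1 / a ^ 3 * (1 / (((p.1 : ℝ) + 1) * (p.1 + 1 + p.2) ^ 2)) := by
  have hlow := affine_lower_bound ha1 hx p
  have hp2 : (0 : ℝ) ≤ p.2 := p.2.cast_nonneg
  have hle : a * ((p.1 : ℝ) + 1) ≤ ((p.1 : ℝ) + 1) * x + p.2 + 1 := by
    nlinarith [mul_nonneg ha.le hp2]
  rw [herglotzKernel, div_mul_div_comm, one_mul]
  calc 1 / ((((p.1 : ℝ) + 1) * x + p.2) ^ 2 * (((p.1 : ℝ) + 1) * x + p.2 + 1))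
      ≤ 1 / ((a * (p.1 + 1 + p.2)) ^ 2 * (a * ((p.1 : ℝ) + 1))) := by
        gcongr
    _ = 1 / (a ^ 3 * (((p.1 : ℝ) + 1) * (p.1 + 1 + p.2) ^ 2)) := by
        congr 1
        ring

theorem summable_herglotzKernel {x : ℝ} (hx : 0 < x) :
    Summable fun p : ℕ × ℕ => herglotzKernel (((p.1 : ℝ) + 1) * x + p.2) :=
  (summable_prod_majorant.mul_left (1 / (min x 1) ^ 3)).of_nonneg_of_le
    (fun p => herglotzKernel_nonneg (by positivity))
    fun p => herglotzKernel_le (lt_min hx one_pos) (min_le_right _ _) (min_le_left _ _) p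

theorem hasDerivAt_herglotzF {x : ℝ} (hx : 0 < x) :
    HasDerivAt herglotzF (∑' p : ℕ × ℕ, herglotzKernel (((p.1 : ℝ) + 1) * x + p.2)) x := by
  have ha : 0 < min x 1 / 2 := half_pos (lt_min hx one_pos)
  have hmin1 := min_le_right x 1
  have hminx := min_le_left x 1
  have hxa : x ∈ Set.Ioi (min x 1 / 2) := by
    simp only [Set.mem_Ioi]
    linarith
  have key := hasDerivAt_tsum_of_isPreconnected
    (g := fun (p : ℕ × ℕ) y => -digammaStep (((p.1 : ℝ) + 1) * y + p.2) / (p.1 + 1))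
    (g' := fun p y => herglotzKernel (((p.1 : ℝ) + 1) * y + p.2))
    (summable_prod_majorant.mul_left (1 / (min x 1 / 2) ^ 3)) isOpen_Ioi
    (convex_Ioi (min x 1 / 2)).isPreconnected
    (fun p y hy => by
      have hy0 : 0 < y := ha.trans hy
      have hlin : HasDerivAt (fun y : ℝ => ((p.1 : ℝ) + 1) * y + p.2) ((p.1 : ℝ) + 1) y := by
        simpa using ((hasDerivAt_id y).const_mul ((p.1 : ℝ) + 1)).add_const (p.2 : ℝ)
      have hcomp := ((hasDerivAt_digammaStep
        (by positivity : 0 < ((p.1 : ℝ) + 1) * y + p.2)).comp y hlin).neg.div_const ((p.1 : ℝ) + 1)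
      refine hcomp.congr_deriv ?_
      field_simp)
    (fun p y hy => by
      have hy0 : 0 < y := ha.trans hy
      rw [Real.norm_of_nonneg (herglotzKernel_nonneg (by positivity))]
      exact herglotzKernel_le ha (by linarith) (le_of_lt hy) p)
    hxa (summable_digammaStep_prod hx) hxa
  refine key.congr_of_eventuallyEq ?_
  filter_upwards [lt_mem_nhds hx] with y hy using herglotzF_eq_tsum_prod hy

theorem tsum_herglotzKernel_one :
    ∑' p : ℕ × ℕ, herglotzKernel (((p.1 : ℝ) + 1) * 1 + p.2) = 1 := by
  have hs := (summable_herglotzKernel one_pos).hasSum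
  rw [← Finset.HasAntidiagonal.sigmaAntidiagonalEquivProd.hasSum_iff] at hs
  have hN := hs.sigma fun N => hasSum_fintype _
  have hval : HasSum (fun N : ℕ => 1 / (((N : ℝ) + 1) * (N + 2))) 1 := by
    rw [hasSum_iff_tendsto_nat_of_nonneg fun N => by positivity]
    have hsum (M : ℕ) : ∑ N ∈ Finset.range M, 1 / (((N : ℝ) + 1) * (N + 2)) =
        1 - 1 / ((M : ℝ) + 1) := by
      induction M with
      | zero => simp
      | succ M ih =>
        rw [Finset.sum_range_succ, ih]
        push_cast
        field_simp
        ring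
    simp_rw [hsum]
    simpa using (tendsto_one_div_add_atTop_nhds_zero_nat (𝕜 := ℝ)).const_sub 1
  refine hN.unique ?_
  convert hval using 2 with N
  have hterm (c : Finset.HasAntidiagonal.antidiagonal N) :
      herglotzKernel (((c.1.1 : ℝ) + 1) * 1 + c.1.2) = 1 / (((N : ℝ) + 1) ^ 2 * (N + 2)) := by
    have hc : (c.1.1 : ℝ) + c.1.2 = N := by
      exact_mod_cast Finset.HasAntidiagonal.mem_antidiagonal.1 c.2
    rw [herglotzKernel, ← hc]
    ring_nf
  refine (Finset.sum_congr rfl fun c _ => hterm c).trans ?_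
  simp only [Finset.sum_const, Finset.card_univ, Fintype.card_coe,
    Finset.Nat.card_antidiagonal, nsmul_eq_mul]
  push_cast
  field_simp

theorem pow_sub_one_sub_log_nonneg (q : ℕ) {y : ℝ} (hy : 0 < y) :
    0 ≤ y ^ q - 1 - q * Real.log y := by
  have h := Real.log_le_sub_one_of_pos (pow_pos hy q)
  rw [Real.log_pow] at h
  linarith

theorem integral_pow_sub_one_sub_log_mul_pow (M q : ℕ) :
    MeasureTheory.IntegrableOn (fun y : ℝ => (y ^ q - 1 - q * Real.log y) * y ^ M)
        (Set.Ioo 0 1) ∧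
      ∫ y in Set.Ioo (0 : ℝ) 1, (y ^ q - 1 - q * Real.log y) * y ^ M =
        (q : ℝ) ^ 2 / (((M : ℝ) + 1) ^ 2 * ((M : ℝ) + 1 + q)) := by
  let f : ℝ → ℝ := fun y => y ^ (M + 1 + q) / ((M : ℝ) + 1 + q) - y ^ (M + 1) / ((M : ℝ) + 1)
    - q * (y ^ (M + 1) * Real.log y / ((M : ℝ) + 1) - y ^ (M + 1) / ((M : ℝ) + 1) ^ 2)
  have hf : ContinuousOn f (Set.Icc 0 1) := by
    have hlog : Continuous fun y : ℝ => y ^ (M + 1) * Real.log y := by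
      simp_rw [pow_succ, mul_assoc]
      exact (continuous_pow M).mul Real.continuous_mul_log
    apply Continuous.continuousOn
    dsimp only [f]
    fun_prop
  have hderiv : ∀ y ∈ Set.Ioo (0 : ℝ) 1,
      HasDerivAt f ((y ^ q - 1 - q * Real.log y) * y ^ M) y := by
    intro y hy
    have hy0 : y ≠ 0 := hy.1.ne'
    have h1 := (hasDerivAt_pow (M + 1 + q) y).div_const ((M : ℝ) + 1 + q)
    have h2 := (hasDerivAt_pow (M + 1) y).div_const ((M : ℝ) + 1)
    have h3 := (hasDerivAt_pow (M + 1) y).div_const (((M : ℝ) + 1) ^ 2)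
    have h4 := ((hasDerivAt_pow (M + 1) y).mul (Real.hasDerivAt_log hy0)).div_const ((M : ℝ) + 1)
    have h5 := (h1.sub h2).sub ((h4.sub h3).const_mul (q : ℝ))
    refine h5.congr_deriv ?_
    have e : M + 1 + q - 1 = M + q := by omega
    rw [e]
    push_cast
    have : (M : ℝ) + 1 + q ≠ 0 := by positivity
    field_simp
    ring
  have hint := intervalIntegral.integrableOn_deriv_of_nonneg hf hderiv fun y hy =>
    mul_nonneg (pow_sub_one_sub_log_nonneg q hy.1) (pow_nonneg hy.1.le M)
  refine ⟨hint.mono_set Set.Ioo_subset_Ioc_self, ?_⟩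
  rw [← MeasureTheory.integral_Ioc_eq_integral_Ioo, ← intervalIntegral.integral_of_le zero_le_one,
    intervalIntegral.integral_eq_sub_of_hasDerivAt_of_le zero_le_one hf hderiv
      ((intervalIntegrable_iff_integrableOn_Ioc_of_le zero_le_one).2 hint)]
  have : (M : ℝ) + 1 + q ≠ 0 := by positivity
  have e : M + 1 + q = M + q + 1 := by omega
  simp only [f, e, one_pow, Real.log_one, zero_mul, mul_zero, zero_div, zero_pow (Nat.succ_ne_zero _)]
  field_simp
  ring

/-- The integrand whose integral over (0,1) is x times the derivative of F at x = p/q. -/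
noncomputable def herglotzIntegrand (p q : ℕ) (y : ℝ) : ℝ :=
  p * (y ^ q - 1 - q * Real.log y) * y ^ (p - 1) / ((1 - y ^ p) * (1 - y ^ q))

theorem hasSum_herglotzIntegrand {p q : ℕ} (hp : 0 < p) (hq : 0 < q) {y : ℝ}
    (hy : y ∈ Set.Ioo (0 : ℝ) 1) :
    HasSum (fun i : ℕ × ℕ => p * ((y ^ q - 1 - q * Real.log y) * y ^ (p - 1 + i.1 * p + i.2 * q)))
      (herglotzIntegrand p q y) := by
  have hgeom {r : ℕ} (hr : 0 < r) : HasSum (fun n : ℕ => (y ^ r) ^ n) (1 - y ^ r)⁻¹ :=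
    hasSum_geometric_of_lt_one (pow_nonneg hy.1.le r) (pow_lt_one₀ hy.1.le hy.2 hr.ne')
  have hsum := (hgeom hp).mul (hgeom hq) ((hgeom hp).summable.mul_of_nonneg (hgeom hq).summable
    (fun n => by have := hy.1; positivity) fun n => by have := hy.1; positivity)
  rw [herglotzIntegrand, div_eq_mul_inv, mul_inv]
  refine (hsum.mul_left (p * (y ^ q - 1 - q * Real.log y) * y ^ (p - 1))).congr_fun fun i => ?_
  ring

theorem integral_herglotzIntegrand {p q : ℕ} (hp : 0 < p) (hq : 0 < q) :
    MeasureTheory.IntegrableOn (herglotzIntegrand p q) (Set.Ioo 0 1) ∧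
      ∫ y in Set.Ioo (0 : ℝ) 1, herglotzIntegrand p q y =
        (p : ℝ) / q * deriv herglotzF ((p : ℝ) / q) := by
  have hp' : (0 : ℝ) < p := Nat.cast_pos.2 hp
  have hq' : (0 : ℝ) < q := Nat.cast_pos.2 hq
  have hx : 0 < (p : ℝ) / q := by positivity
  have hterm (i : ℕ × ℕ) := integral_pow_sub_one_sub_log_mul_pow (p - 1 + i.1 * p + i.2 * q) q
  have hval (i : ℕ × ℕ) : ∫ y in Set.Ioo (0 : ℝ) 1,
      p * ((y ^ q - 1 - q * Real.log y) * y ^ (p - 1 + i.1 * p + i.2 * q)) =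
        (p : ℝ) / q * herglotzKernel (((i.1 : ℝ) + 1) * ((p : ℝ) / q) + i.2) := by
    have hM : ((p - 1 + i.1 * p + i.2 * q : ℕ) : ℝ) + 1 = (i.1 + 1) * p + i.2 * q := by
      push_cast [Nat.cast_sub hp]
      ring
    have hN : (0 : ℝ) < (i.1 + 1) * p + i.2 * q := by positivity
    rw [MeasureTheory.integral_const_mul, (hterm i).2, hM, herglotzKernel]
    have e : ((i.1 : ℝ) + 1) * ((p : ℝ) / q) + i.2 = ((i.1 + 1) * p + i.2 * q) / q := by
      field_simp
    rw [e]
    field_simp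
  have hs := (summable_herglotzKernel hx).mul_left ((p : ℝ) / q)
  have key := MeasureTheory.hasSum_integral_of_summable_integral_norm
    (μ := MeasureTheory.volume.restrict (Set.Ioo (0 : ℝ) 1))
    (F := fun (i : ℕ × ℕ) y =>
      p * ((y ^ q - 1 - q * Real.log y) * y ^ (p - 1 + i.1 * p + i.2 * q)))
    (fun i => (hterm i).1.const_mul (p : ℝ))
    (by
      refine hs.congr fun i => ?_
      rw [← hval i]
      refine MeasureTheory.setIntegral_congr_fun measurableSet_Ioo fun y hy => ?_
      have := pow_sub_one_sub_log_nonneg q hy.1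
      have := hy.1
      exact (Real.norm_of_nonneg (by positivity)).symm)
  have hval' : ∫ y in Set.Ioo (0 : ℝ) 1, herglotzIntegrand p q y =
      (p : ℝ) / q * deriv herglotzF ((p : ℝ) / q) := by
    rw [(hasDerivAt_herglotzF hx).deriv, ← tsum_mul_left, ← tsum_congr hval, key.tsum_eq]
    exact MeasureTheory.setIntegral_congr_fun measurableSet_Ioo fun y hy =>
      (hasSum_herglotzIntegrand hp hq hy).tsum_eq.symm
  refine ⟨MeasureTheory.Integrable.of_integral_ne_zero ?_, hval'⟩
  rw [hval', (hasDerivAt_herglotzF hx).deriv]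
  refine (mul_pos hx ((summable_herglotzKernel hx).tsum_pos
    (fun i => herglotzKernel_nonneg (by positivity)) (0, 0) ?_)).ne'
  unfold herglotzKernel
  positivity

theorem deriv_herglotzF_one : deriv herglotzF 1 = 1 := by
  rw [(hasDerivAt_herglotzF one_pos).deriv, tsum_herglotzKernel_one]

theorem isPrimitiveRoot_rootOfUnity {m : ℕ} (hm : 0 < m) : IsPrimitiveRoot (rootOfUnity 1 m) m := by
  simpa [rootOfUnity] using Complex.isPrimitiveRoot_exp m hm.ne'

theorem rootOfUnity_eq_pow (k m : ℕ) : rootOfUnity k m = rootOfUnity 1 m ^ k := by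
  rw [rootOfUnity, rootOfUnity, ← Complex.exp_nat_mul]
  congr 1
  push_cast
  ring

theorem norm_rootOfUnity {m : ℕ} (hm : 0 < m) (k : ℕ) : ‖rootOfUnity k m‖ = 1 := by
  rw [rootOfUnity_eq_pow, norm_pow, (isPrimitiveRoot_rootOfUnity hm).norm'_eq_one hm.ne', one_pow]

theorem rootOfUnity_ne_one {m j : ℕ} (hj : j ∈ Finset.Ico 1 m) : rootOfUnity j m ≠ 1 := by
  rw [Finset.mem_Ico] at hj
  rw [rootOfUnity_eq_pow]
  exact (isPrimitiveRoot_rootOfUnity (by omega)).pow_ne_one_of_pos_of_lt (by omega) hj.2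

theorem rootOfUnity_pow {m : ℕ} (hm : 0 < m) (k : ℕ) : rootOfUnity k m ^ m = 1 := by
  rw [rootOfUnity_eq_pow, pow_right_comm, (isPrimitiveRoot_rootOfUnity hm).pow_eq_one, one_pow]

theorem one_sub_rootOfUnity_mul_ne_zero {m : ℕ} (hm : 0 < m) (k : ℕ) {z : ℂ} (hz : z ^ m ≠ 1) :
    1 - rootOfUnity k m * z ≠ 0 := fun h => hz <| by
  calc z ^ m = (rootOfUnity k m * z) ^ m := by rw [mul_pow, rootOfUnity_pow hm, one_mul]
    _ = 1 := by rw [← sub_eq_zero.1 h, one_pow]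

theorem sum_inv_one_sub_rootOfUnity_mul {m : ℕ} (hm : 0 < m) {z : ℂ} (hz : z ^ m ≠ 1) :
    ∑ k ∈ Finset.range m, (1 - rootOfUnity k m * z)⁻¹ = m / (1 - z ^ m) := by
  have hζ := isPrimitiveRoot_rootOfUnity hm
  have hz' : 1 - z ^ m ≠ 0 := sub_ne_zero.2 hz.symm
  have hinv (k : ℕ) : (1 - rootOfUnity k m * z)⁻¹ =
      (∑ i ∈ Finset.range m, (rootOfUnity k m * z) ^ i) / (1 - z ^ m) := by
    rw [eq_div_iff hz', inv_mul_eq_iff_eq_mul₀ (one_sub_rootOfUnity_mul_ne_zero hm k hz),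
      mul_neg_geom_sum, mul_pow, rootOfUnity_pow hm, one_mul]
  have hsum : ∀ i ∈ Finset.range m, i ≠ 0 →
      ∑ k ∈ Finset.range m, (rootOfUnity k m * z) ^ i = 0 := by
    intro i hi hi0
    have hne : rootOfUnity 1 m ^ i ≠ 1 :=
      hζ.pow_ne_one_of_pos_of_lt hi0 (Finset.mem_range.1 hi)
    have h0 : ∑ k ∈ Finset.range m, (rootOfUnity 1 m ^ i) ^ k = 0 := by
      rw [geom_sum_eq hne, pow_right_comm, hζ.pow_eq_one, one_pow, sub_self, zero_div]
    calc ∑ k ∈ Finset.range m, (rootOfUnity k m * z) ^ i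
        = ∑ k ∈ Finset.range m, (rootOfUnity 1 m ^ i) ^ k * z ^ i :=
          Finset.sum_congr rfl fun k _ => by
            rw [mul_pow, rootOfUnity_eq_pow k, pow_right_comm]
      _ = 0 := by rw [← Finset.sum_mul, h0, zero_mul]
  simp_rw [hinv, ← Finset.sum_div]
  rw [Finset.sum_comm, Finset.sum_eq_single_of_mem 0 (Finset.mem_range.2 hm) hsum]
  simp

theorem sum_rootOfUnity_div_one_sub {m : ℕ} (hm : 0 < m) {z : ℂ} (hz0 : z ≠ 0) (hz : z ^ m ≠ 1) :
    ∑ k ∈ Finset.range m, rootOfUnity k m / (1 - rootOfUnity k m * z) =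
      m * z ^ (m - 1) / (1 - z ^ m) := by
  have hz' : 1 - z ^ m ≠ 0 := sub_ne_zero.2 hz.symm
  have hterm (k : ℕ) : rootOfUnity k m / (1 - rootOfUnity k m * z) =
      ((1 - rootOfUnity k m * z)⁻¹ - 1) / z := by
    have := one_sub_rootOfUnity_mul_ne_zero hm k hz
    field_simp
    ring
  simp_rw [hterm, ← Finset.sum_div, Finset.sum_sub_distrib, sum_inv_one_sub_rootOfUnity_mul hm hz]
  have hpow : z ^ m = z ^ (m - 1) * z := (pow_sub_one_mul hm.ne' z).symm
  simp only [Finset.sum_const, Finset.card_range, nsmul_eq_mul, mul_one]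
  rw [div_eq_div_iff hz0 hz', sub_mul, div_mul_cancel₀ _ hz', hpow]
  ring

theorem sum_Ico_inv_one_sub_rootOfUnity_mul {m : ℕ} (hm : 0 < m) {z : ℂ} (hz : z ^ m ≠ 1) :
    ∑ j ∈ Finset.Ico 1 m, (1 - rootOfUnity j m * z)⁻¹ = m / (1 - z ^ m) - (1 - z)⁻¹ := by
  rw [← sum_inv_one_sub_rootOfUnity_mul hm hz, Finset.range_eq_Ico,
    Finset.sum_eq_sum_Ico_succ_bot hm]
  simp [rootOfUnity]

/-- The integrand of `gInt`, including the sign. -/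
noncomputable def gIntegrand (α β : ℂ) (y : ℝ) : ℂ :=
  -(α * Complex.log (y : ℂ) / ((1 - α * (y : ℂ)) * (1 - β * (y : ℂ))))

theorem gInt_eq_setIntegral (α β : ℂ) :
    gInt α β = ∫ y in Set.Ioo (0 : ℝ) 1, gIntegrand α β y := by
  rw [gInt, intervalIntegral.integral_of_le zero_le_one,
    MeasureTheory.integral_Ioc_eq_integral_Ioo, ← MeasureTheory.integral_neg]
  rfl

theorem one_sub_mul_ofReal_ne_zero {β : ℂ} (hβ : ‖β‖ = 1) (hβ1 : β ≠ 1) {y : ℝ} (hy : 0 ≤ y) :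
    1 - β * (y : ℂ) ≠ 0 := by
  intro h
  have h1 : β * (y : ℂ) = 1 := (sub_eq_zero.1 h).symm
  have h2 : y = 1 := by
    have := congrArg norm h1
    simpa [hβ, abs_of_nonneg hy] using this
  exact hβ1 (by simpa [h2] using h1)

theorem norm_log_div_one_sub_le {α : ℂ} (hα : ‖α‖ = 1) {y : ℝ} (hy : y ∈ Set.Ioo (0 : ℝ) 1) :
    ‖α * Complex.log (y : ℂ) / (1 - α * (y : ℂ))‖ ≤ 1 - Real.log y := by
  have hy1 : 0 < 1 - y := sub_pos.2 hy.2
  have hden : 1 - y ≤ ‖1 - α * (y : ℂ)‖ := by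
    have := norm_sub_norm_le (1 : ℂ) (α * y)
    simpa [hα, abs_of_pos hy.1] using this
  have hlog : Real.log y ≤ 0 := Real.log_nonpos hy.1.le hy.2.le
  have hinv := Real.one_sub_inv_le_log_of_pos hy.1
  have hylog : y - 1 ≤ y * Real.log y := by
    have := mul_le_mul_of_nonneg_left hinv hy.1.le
    rwa [mul_sub, mul_one, mul_inv_cancel₀ hy.1.ne'] at this
  rw [norm_div, norm_mul, hα, one_mul, ← Complex.ofReal_log hy.1.le, Complex.norm_real,
    Real.norm_of_nonpos hlog, div_le_iff₀ (hy1.trans_le hden)]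
  calc -Real.log y ≤ (1 - Real.log y) * (1 - y) := by linarith
    _ ≤ _ := mul_le_mul_of_nonneg_left hden (by linarith)

theorem integrableOn_gIntegrand {α β : ℂ} (hα : ‖α‖ = 1) (hβ : ‖β‖ = 1) (hβ1 : β ≠ 1) :
    MeasureTheory.IntegrableOn (gIntegrand α β) (Set.Ioo 0 1) := by
  have hcont : ContinuousOn (fun y : ℝ => (1 - β * (y : ℂ))⁻¹) (Set.Icc 0 1) :=
    ContinuousOn.inv₀ (by fun_prop) fun y hy => one_sub_mul_ofReal_ne_zero hβ hβ1 hy.1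
  obtain ⟨C, hC⟩ := isCompact_Icc.exists_bound_of_continuousOn hcont
  have hlog : MeasureTheory.IntegrableOn (fun y => C * (1 - Real.log y)) (Set.Ioo 0 1) := by
    have h : IntervalIntegrable (fun y => C * (1 - Real.log y)) MeasureTheory.volume 0 1 :=
      (intervalIntegrable_const.sub intervalIntegral.intervalIntegrable_log').const_mul C
    exact ((intervalIntegrable_iff_integrableOn_Ioc_of_le zero_le_one).1 h).mono_set
      Set.Ioo_subset_Ioc_self
  refine hlog.mono' ?_ ?_
  · have : Measurable (gIntegrand α β) := by
      unfold gIntegrand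
      fun_prop
    exact this.aestronglyMeasurable
  · refine (MeasureTheory.ae_restrict_iff' measurableSet_Ioo).2 (Filter.Eventually.of_forall ?_)
    intro y hy
    rw [gIntegrand, norm_neg, ← div_div, div_eq_mul_inv, norm_mul, mul_comm]
    have h1 := hC y (Set.Ioo_subset_Icc_self hy)
    exact mul_le_mul h1 (norm_log_div_one_sub_le hα hy) (norm_nonneg _) ((norm_nonneg _).trans h1)

theorem sum_gIntegrand {p r : ℕ} (hp : 0 < p) (hr : 0 < r) {y : ℝ} (hy : y ∈ Set.Ioo (0 : ℝ) 1) :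
    ∑ k ∈ Finset.range p, ∑ j ∈ Finset.Ico 1 r,
        gIntegrand (rootOfUnity k p) (rootOfUnity j r) y =
      -(Complex.log y * (p * (y : ℂ) ^ (p - 1) / (1 - (y : ℂ) ^ p)) *
        (r / (1 - (y : ℂ) ^ r) - (1 - (y : ℂ))⁻¹)) := by
  have hpow {m : ℕ} (hm : 0 < m) : (y : ℂ) ^ m ≠ 1 := by
    exact_mod_cast (pow_lt_one₀ hy.1.le hy.2 hm.ne').ne
  have hy0 : (y : ℂ) ≠ 0 := Complex.ofReal_ne_zero.2 hy.1.ne'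
  rw [← sum_rootOfUnity_div_one_sub hp hy0 (hpow hp),
    ← sum_Ico_inv_one_sub_rootOfUnity_mul hr (hpow hr), mul_assoc, Finset.sum_mul_sum,
    Finset.mul_sum, ← Finset.sum_neg_distrib]
  refine Finset.sum_congr rfl fun k _ => ?_
  rw [Finset.mul_sum, ← Finset.sum_neg_distrib]
  refine Finset.sum_congr rfl fun j _ => ?_
  rw [gIntegrand, ← div_div, div_eq_mul_inv _ (1 - rootOfUnity j r * (y : ℂ))]
  ring

theorem sum_gInt_eq_setIntegral {p r : ℕ} (hp : 0 < p) (hr : 0 < r) :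
    MeasureTheory.IntegrableOn (fun y => ∑ k ∈ Finset.range p, ∑ j ∈ Finset.Ico 1 r,
        gIntegrand (rootOfUnity k p) (rootOfUnity j r) y) (Set.Ioo 0 1) ∧
      ∑ k ∈ Finset.range p, ∑ j ∈ Finset.Ico 1 r, gInt (rootOfUnity k p) (rootOfUnity j r) =
        ∫ y in Set.Ioo (0 : ℝ) 1, ∑ k ∈ Finset.range p, ∑ j ∈ Finset.Ico 1 r,
          gIntegrand (rootOfUnity k p) (rootOfUnity j r) y := by
  have hint (k : ℕ) : ∀ j ∈ Finset.Ico 1 r, MeasureTheory.IntegrableOn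
      (gIntegrand (rootOfUnity k p) (rootOfUnity j r)) (Set.Ioo 0 1) := fun j hj =>
    integrableOn_gIntegrand (norm_rootOfUnity hp k) (norm_rootOfUnity hr j) (rootOfUnity_ne_one hj)
  have hint' (k : ℕ) := MeasureTheory.integrable_finsetSum _ (hint k)
  refine ⟨MeasureTheory.integrable_finsetSum _ fun k _ => hint' k, ?_⟩
  rw [MeasureTheory.integral_finsetSum _ fun k _ => hint' k]
  refine Finset.sum_congr rfl fun k _ => ?_
  rw [MeasureTheory.integral_finsetSum _ (hint k)]
  exact Finset.sum_congr rfl fun j _ => gInt_eq_setIntegral _ _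

theorem herglotzIntegrand_sub {p q : ℕ} (hp : 0 < p) (hq : 0 < q) {y : ℝ}
    (hy : y ∈ Set.Ioo (0 : ℝ) 1) :
    ((herglotzIntegrand p q y - herglotzIntegrand p p y : ℝ) : ℂ) =
      (∑ k ∈ Finset.range p, ∑ j ∈ Finset.Ico 1 q,
          gIntegrand (rootOfUnity k p) (rootOfUnity j q) y) -
        ∑ k ∈ Finset.range p, ∑ j ∈ Finset.Ico 1 p,
          gIntegrand (rootOfUnity k p) (rootOfUnity j p) y := by
  have hpow {m : ℕ} (hm : 0 < m) : 1 - (y : ℂ) ^ m ≠ 0 := by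
    exact_mod_cast sub_ne_zero.2 (pow_lt_one₀ hy.1.le hy.2 hm.ne').ne'
  rw [sum_gIntegrand hp hq hy, sum_gIntegrand hp hp hy, herglotzIntegrand, herglotzIntegrand,
    ← Complex.ofReal_log hy.1.le]
  push_cast
  have h1 := hpow hp
  have h2 := hpow hq
  have h3 : 1 - (y : ℂ) ≠ 0 := by simpa using hpow one_pos
  field_simp
  ring

/-- F is differentiable on (0,∞), F′(1) = 1, and (p/q)·F′(p/q) − 1 is the stated
sum of the integrals g(α,β) over roots of unity. -/
theorem herglotzF_deriv_at_rationals :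
    (∀ x : ℝ, 0 < x → DifferentiableAt ℝ herglotzF x) ∧
    deriv herglotzF 1 = 1 ∧
    ∀ p q : ℕ, 0 < p → 0 < q → Nat.Coprime p q →
      ((((p : ℝ) / q) * deriv herglotzF ((p : ℝ) / q) - 1 : ℝ) : ℂ) =
        ∑ k ∈ Finset.range p,
          ((∑ j ∈ Finset.Ico 1 q, gInt (rootOfUnity k p) (rootOfUnity j q))
            - ∑ j ∈ Finset.Ico 1 p, gInt (rootOfUnity k p) (rootOfUnity j p)) := by
  refine ⟨fun x hx => (hasDerivAt_herglotzF hx).differentiableAt, deriv_herglotzF_one,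
    fun p q hp hq _ => ?_⟩
  have hpq := integral_herglotzIntegrand hp hq
  have hpp := integral_herglotzIntegrand hp hp
  rw [div_self (Nat.cast_ne_zero.2 hp.ne'), deriv_herglotzF_one, one_mul] at hpp
  have hq_sum := sum_gInt_eq_setIntegral hp hq
  have hp_sum := sum_gInt_eq_setIntegral hp hp
  rw [Finset.sum_sub_distrib, hq_sum.2, hp_sum.2, ← MeasureTheory.integral_sub hq_sum.1 hp_sum.1,
    ← hpq.2]
  nth_rewrite 2 [← hpp.2]
  rw [← MeasureTheory.integral_sub hpq.1 hpp.1, ← integral_complex_ofReal]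
  exact MeasureTheory.setIntegral_congr_fun measurableSet_Ioo fun y hy =>
    herglotzIntegrand_sub hp hq hy
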